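/- For every integer k ≥ 2 there exists a constant c_k > 0 with the following property. Let G be an abelian group, A a finite nonempty subset of G, and β, γ ∈ (0,1] with β ≤ 1/2. Let D, S ⊆ G be finite sets with A − A ⊆ D and A + A ⊆ S. Suppose that A is (k+1,β,γ)-connected and E_{k+1}(A) ≥ 2^{k+2}·γ⁻¹·|A|^{k+1}. Then Σ_{x ≠ 0} |A ∩ (A − x)|^k · |D ∩ (D − x)|^k ≥ c_k·γ·|A|^{2k+1} and Σ_{x ≠ 0} |A ∩ (A − x)|^k · |S ∩ (S − x)|^k ≥ c_k·γ·|A|^{2k+1}. -/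

import Mathlib

open Finset Pointwise

universe u

variable {G : Type*} [AddCommGroup G] [DecidableEq G]

/-- `A_s = A ∩ (A - s) = {x ∈ A : x + s ∈ A}`. -/
def stab (A : Finset G) (s : G) : Finset G := A ∩ A.image (fun a => a - s)

/-- `E_k(A) = ∑_{s ∈ G} |A_s|^k` (the summand vanishes off `A - A`). -/
def energyK (k : ℕ) (A : Finset G) : ℕ := ∑ s ∈ A - A, (stab A s).card ^ k

/-- `(k, β, γ)`-connectedness: every `B ⊆ A` with `|B| ≥ β|A|` satisfies
`E_k(B) ≥ γ (|B|/|A|)^{2k} E_k(A)`. -/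
def conn (k : ℕ) (β γ : ℝ) (A : Finset G) : Prop :=
  ∀ B ⊆ A, β * (A.card : ℝ) ≤ (B.card : ℝ) →
    γ * ((B.card : ℝ) / (A.card : ℝ)) ^ (2 * k) * (energyK k A : ℝ) ≤ (energyK k B : ℝ)

lemma mem_stab' {G : Type*} [AddCommGroup G] [DecidableEq G] (A : Finset G) (s t : G) :
    t ∈ stab A s ↔ t ∈ A ∧ t + s ∈ A := by
  unfold stab
  rw [Finset.mem_inter, Finset.mem_image]
  constructor
  · rintro ⟨h, a, ha, rfl⟩
    exact ⟨h, by simpa using ha⟩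
  · rintro ⟨h, h'⟩
    exact ⟨h, t + s, h', by simp⟩

lemma cs_sets {ι α : Type*} [DecidableEq α] (X : Finset ι) (U : Finset α)
    (P : ι → Finset α) (hP : ∀ b ∈ X, P b ⊆ U) :
    (∑ b ∈ X, (P b).card) ^ 2 ≤ U.card * ∑ b ∈ X, ∑ c ∈ X, (P b ∩ P c).card := by
  have h1 : ∑ b ∈ X, (P b).card = ∑ u ∈ U, ∑ b ∈ X, (if u ∈ P b then 1 else 0) := by
    rw [Finset.sum_comm]
    refine Finset.sum_congr rfl fun b hb => ?_
    rw [← Finset.card_filter, Finset.filter_mem_eq_inter,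
      Finset.inter_eq_right.mpr (hP b hb)]
  have h2 : ∑ b ∈ X, ∑ c ∈ X, (P b ∩ P c).card
      = ∑ u ∈ U, (∑ b ∈ X, (if u ∈ P b then 1 else 0)) ^ 2 := by
    simp_rw [sq, Finset.sum_mul_sum]
    rw [Finset.sum_comm (s := U)]
    refine Finset.sum_congr rfl fun b hb => ?_
    rw [Finset.sum_comm (s := U)]
    refine Finset.sum_congr rfl fun c hc => ?_
    have : ∀ u, (if u ∈ P b then 1 else 0) * (if u ∈ P c then 1 else 0)
        = if u ∈ P b ∩ P c then 1 else 0 := by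
      intro u
      by_cases h : u ∈ P b <;> by_cases h' : u ∈ P c <;> simp [h, h']
    simp_rw [this]
    rw [← Finset.card_filter, Finset.filter_mem_eq_inter,
      Finset.inter_eq_right.mpr (Finset.inter_subset_left.trans (hP b hb))]
  rw [h1, h2]
  exact sq_sum_le_card_mul_sum_sq

lemma cs_pow {ι α : Type*} [DecidableEq α] (k : ℕ) (X : Finset ι) (U : Finset α)
    (N : ι → Finset α) (hN : ∀ b ∈ X, N b ⊆ U) :
    (∑ b ∈ X, (N b).card ^ k) ^ 2
      ≤ U.card ^ k * ∑ b ∈ X, ∑ c ∈ X, (N b ∩ N c).card ^ k := by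
  have := cs_sets X (Fintype.piFinset fun _ : Fin k => U)
    (fun b => Fintype.piFinset fun _ : Fin k => N b)
    (fun b hb => Fintype.piFinset_subset _ _ fun _ => hN b hb)
  have h : ∀ b c, (Fintype.piFinset fun _ : Fin k => N b) ∩ (Fintype.piFinset fun _ : Fin k => N c)
      = Fintype.piFinset fun _ : Fin k => N b ∩ N c := by
    intro b c
    ext f
    simp [Fintype.mem_piFinset, forall_and]
  simp_rw [h] at this
  simpa using this

lemma sum_pairs {G : Type*} [AddCommGroup G] [DecidableEq G] (k : ℕ) (A : Finset G) :
    ∑ b ∈ A, ∑ c ∈ A, (stab A (b - c)).card ^ k = energyK (k + 1) A := by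
  unfold energyK
  rw [← Finset.sum_product' A A (fun b c => (stab A (b - c)).card ^ k),
    ← Finset.sum_fiberwise_of_maps_to (s := A ×ˢ A) (t := A - A) (g := fun p => p.1 - p.2)]
  · refine Finset.sum_congr rfl fun s hs => ?_
    rw [Finset.sum_congr rfl (g := fun _ => (stab A s).card ^ k)]
    · rw [Finset.sum_const, smul_eq_mul, pow_succ, mul_comm]
      congr 1
      refine Finset.card_bij (fun p _ => p.2) ?_ ?_ ?_
      · rintro ⟨a, b⟩ h
        simp only [Finset.mem_filter, Finset.mem_product] at h
        rw [mem_stab', ← h.2]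
        exact ⟨h.1.2, by simpa using h.1.1⟩
      · rintro ⟨a, b⟩ h ⟨a', b'⟩ h' e
        simp only [Finset.mem_filter, Finset.mem_product] at h h' e
        subst e
        have := h.2.trans h'.2.symm
        simpa using this
      · intro b hb
        rw [mem_stab'] at hb
        exact ⟨(b + s, b), by simp [hb.1, hb.2], rfl⟩
    · intro p hp
      rw [(Finset.mem_filter.mp hp).2]
  · intro p hp
    rw [Finset.mem_product] at hp
    exact Finset.sub_mem_sub hp.1 hp.2

/-- Core argument, for a family `T x` of sets containing shifted copies of `A`. -/
lemma core {G : Type*} [AddCommGroup G] [DecidableEq G] (k : ℕ) (A : Finset G)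
    (T : G → Finset G) (N : G → G → Finset G)
    (hsub : ∀ x, ∀ b ∈ stab A x, N x b ⊆ T x)
    (hcard : ∀ x b, (N x b).card = A.card)
    (hint : ∀ x b c, (N x b ∩ N x c).card ≤ (stab A (b - c)).card)
    (β γ : ℝ) (hA : A.Nonempty) (hβ : β ≤ 1 / 2) (hγ : 0 < γ)
    (hconn : conn (k + 1) β γ A)
    (hE : (2 : ℝ) ^ (k + 2) * γ⁻¹ * (A.card : ℝ) ^ (k + 1) ≤ (energyK (k + 1) A : ℝ)) :
    1 / 2 ^ (2 * k + 4) * γ * (A.card : ℝ) ^ (2 * k + 1) ≤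
      ∑ x ∈ (A - A).erase 0, ((stab A x).card : ℝ) ^ k * ((T x).card : ℝ) ^ k := by
  have hA0 : (0 : ℝ) < A.card := by exact_mod_cast hA.card_pos
  set E : ℝ := (energyK (k + 1) A : ℝ) with hEdef
  have hE0 : 0 < E := lt_of_lt_of_le (by positivity) hE
  let f : G → ℝ := fun b => ∑ c ∈ A, ((stab A (b - c)).card : ℝ) ^ k
  have hf0 : ∀ b, 0 ≤ f b := fun b => Finset.sum_nonneg fun _ _ => by positivity
  have hfsum : ∑ b ∈ A, f b = E := by
    rw [hEdef, ← sum_pairs]; push_cast; rfl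
  let B : Finset G := A.filter fun b => f b * A.card ≤ 2 * E
  have hBA : B ⊆ A := Finset.filter_subset _ _
  -- `B` is large
  have hBc : (A.card : ℝ) / 2 ≤ B.card := by
    let C : Finset G := A.filter fun b => ¬ f b * A.card ≤ 2 * E
    have hBC : (B.card : ℝ) + C.card = A.card := by
      exact_mod_cast Finset.card_filter_add_card_filter_not (s := A) _
    have h1 : (C.card : ℝ) * (2 * E) ≤ E * A.card := by
      calc (C.card : ℝ) * (2 * E) = ∑ b ∈ C, 2 * E := by simp
        _ ≤ ∑ b ∈ C, f b * A.card :=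
          Finset.sum_le_sum fun b hb => (not_le.mp (Finset.mem_filter.mp hb).2).le
        _ ≤ ∑ b ∈ A, f b * A.card :=
          Finset.sum_le_sum_of_subset_of_nonneg (Finset.filter_subset _ _)
            fun b _ _ => mul_nonneg (hf0 b) hA0.le
        _ = E * A.card := by rw [← Finset.sum_mul, hfsum]
    have h2 : (C.card : ℝ) * 2 ≤ A.card := by
      refine le_of_mul_le_mul_right (a := E) ?_ hE0
      linarith
    linarith
  have hB0 : (0 : ℝ) < B.card := by linarith
  have hc := hconn B hBA (by nlinarith)
  rw [← hEdef] at hc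
  set ρ : ℝ := (B.card : ℝ) / A.card with hρ
  have hρ2 : 1 / 2 ≤ ρ := by rw [hρ, le_div_iff₀ hA0]; linarith
  have hBρ : (B.card : ℝ) = ρ * A.card := by rw [hρ]; field_simp
  clear_value ρ
  clear hρ
  have hEB1 : γ * (1 / 2) ^ (2 * (k + 1)) * E ≤ (energyK (k + 1) B : ℝ) := by
    refine le_trans ?_ hc
    gcongr
  have hEB2 : 2 * (B.card : ℝ) ^ (k + 1) ≤ (energyK (k + 1) B : ℝ) := by
    refine le_trans ?_ hc
    have h1 : (2 : ℝ) ^ (k + 2) * (A.card : ℝ) ^ (k + 1) ≤ γ * E := by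
      calc (2 : ℝ) ^ (k + 2) * (A.card : ℝ) ^ (k + 1)
          = γ * ((2 : ℝ) ^ (k + 2) * γ⁻¹ * (A.card : ℝ) ^ (k + 1)) := by field_simp
        _ ≤ γ * E := by gcongr
    have h2 : 1 ≤ (2 * ρ) ^ (k + 1) := one_le_pow₀ (by linarith)
    have hρ0 : 0 < ρ := by linarith
    calc 2 * (B.card : ℝ) ^ (k + 1) = 2 * (ρ ^ (k + 1) * (A.card : ℝ) ^ (k + 1)) * 1 := by
          rw [hBρ]; ring
      _ ≤ 2 * (ρ ^ (k + 1) * (A.card : ℝ) ^ (k + 1)) * (2 * ρ) ^ (k + 1) := by gcongr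
      _ = ρ ^ (2 * (k + 1)) * ((2 : ℝ) ^ (k + 2) * (A.card : ℝ) ^ (k + 1)) := by
          rw [mul_pow]; ring
      _ ≤ ρ ^ (2 * (k + 1)) * (γ * E) := by gcongr
      _ = _ := by ring
  have hEB3 : (energyK (k + 1) B : ℝ) ≤
      (B.card : ℝ) ^ (k + 1) + ∑ x ∈ (A - A).erase 0, ((stab B x).card : ℝ) ^ (k + 1) := by
    unfold energyK
    push_cast
    have h0 : (0 : G) ∈ A - A := by
      obtain ⟨a, ha⟩ := hA
      simpa using Finset.sub_mem_sub ha ha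
    have hs0 : stab B 0 = B := by ext t; simp [mem_stab']
    calc ∑ x ∈ B - B, ((stab B x).card : ℝ) ^ (k + 1)
        ≤ ∑ x ∈ A - A, ((stab B x).card : ℝ) ^ (k + 1) :=
          Finset.sum_le_sum_of_subset_of_nonneg (Finset.sub_subset_sub hBA hBA)
            fun _ _ _ => by positivity
      _ = _ := by rw [← Finset.add_sum_erase _ _ h0, hs0]
  -- pointwise bound
  have hpt : ∀ x, (A.card : ℝ) ^ (2 * k + 1) * ((stab B x).card : ℝ) ^ (k + 1) ≤
      2 * E * (((stab A x).card : ℝ) ^ k * ((T x).card : ℝ) ^ k) := by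
    intro x
    have hXA : stab B x ⊆ stab A x := by
      intro t ht
      rw [mem_stab'] at ht ⊢
      exact ⟨hBA ht.1, hBA ht.2⟩
    have hXB : stab B x ⊆ B := fun t ht => ((mem_stab' _ _ _).mp ht).1
    set X := stab B x with hX
    rcases Finset.eq_empty_or_nonempty X with h | h
    · rw [h]; simp; positivity
    have hX0 : (0 : ℝ) < X.card := by exact_mod_cast h.card_pos
    have h1 := cs_pow k X (T x) (N x) (fun b hb => hsub x b (hXA hb))
    simp only [hcard, Finset.sum_const, smul_eq_mul] at h1
    have h1' : ((X.card : ℝ) * (A.card : ℝ) ^ k) ^ 2 ≤ ((T x).card : ℝ) ^ k *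
        ∑ b ∈ X, ∑ c ∈ X, ((N x b ∩ N x c).card : ℝ) ^ k := by exact_mod_cast h1
    have h2 : ∑ b ∈ X, ∑ c ∈ X, ((N x b ∩ N x c).card : ℝ) ^ k ≤ ∑ b ∈ X, f b := by
      refine Finset.sum_le_sum fun b _ => ?_
      calc ∑ c ∈ X, ((N x b ∩ N x c).card : ℝ) ^ k
          ≤ ∑ c ∈ X, ((stab A (b - c)).card : ℝ) ^ k := by
            refine Finset.sum_le_sum fun c _ => ?_
            have := hint x b c
            gcongr
        _ ≤ f b := Finset.sum_le_sum_of_subset_of_nonneg (hXB.trans hBA)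
            fun _ _ _ => by positivity
    have h3 : (∑ b ∈ X, f b) * A.card ≤ X.card * (2 * E) := by
      rw [Finset.sum_mul]
      calc ∑ b ∈ X, f b * A.card ≤ ∑ b ∈ X, 2 * E :=
            Finset.sum_le_sum fun b hb => (Finset.mem_filter.mp (hXB hb)).2
        _ = _ := by simp
    have h4 : (X.card : ℝ) * ((A.card : ℝ) ^ (2 * k + 1) * X.card) ≤
        X.card * (2 * E * ((T x).card : ℝ) ^ k) := by
      calc (X.card : ℝ) * ((A.card : ℝ) ^ (2 * k + 1) * X.card)
          = ((X.card : ℝ) * (A.card : ℝ) ^ k) ^ 2 * A.card := by ring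
        _ ≤ ((T x).card : ℝ) ^ k * (∑ b ∈ X, f b) * A.card := by
            gcongr; exact h1'.trans (by gcongr)
        _ = ((T x).card : ℝ) ^ k * ((∑ b ∈ X, f b) * A.card) := by ring
        _ ≤ ((T x).card : ℝ) ^ k * (X.card * (2 * E)) := by gcongr
        _ = _ := by ring
    have h5 := le_of_mul_le_mul_left h4 hX0
    have h6 : (X.card : ℝ) ≤ (stab A x).card := by exact_mod_cast Finset.card_le_card hXA
    calc (A.card : ℝ) ^ (2 * k + 1) * (X.card : ℝ) ^ (k + 1)
        = (X.card : ℝ) ^ k * ((A.card : ℝ) ^ (2 * k + 1) * X.card) := by ring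
      _ ≤ ((stab A x).card : ℝ) ^ k * (2 * E * ((T x).card : ℝ) ^ k) := by gcongr
      _ = _ := by ring
  have hsum := Finset.sum_le_sum fun x (_ : x ∈ (A - A).erase 0) => hpt x
  rw [← Finset.mul_sum, ← Finset.mul_sum] at hsum
  have hlow : γ * (1 / 2) ^ (2 * (k + 1)) * E / 2 ≤
      ∑ x ∈ (A - A).erase 0, ((stab B x).card : ℝ) ^ (k + 1) := by linarith
  refine le_of_mul_le_mul_left (a := 2 * E) ?_ (by positivity)
  refine le_trans ?_ hsum
  calc 2 * E * (1 / 2 ^ (2 * k + 4) * γ * (A.card : ℝ) ^ (2 * k + 1))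
      = (A.card : ℝ) ^ (2 * k + 1) * (γ * (1 / 2) ^ (2 * (k + 1)) * E / 2) := by
        rw [one_div_pow]
        have : (2 : ℝ) ^ (2 * k + 4) = 4 * 2 ^ (2 * (k + 1)) := by ring
        rw [this]; field_simp; norm_num
    _ ≤ _ := by gcongr

theorem stmt_5 (k : ℕ) (hk : 2 ≤ k) :
    ∃ c : ℝ, 0 < c ∧
      ∀ (G : Type u) [AddCommGroup G] [DecidableEq G] (A D S : Finset G) (β γ : ℝ),
        A.Nonempty →
        A - A ⊆ D → A + A ⊆ S →
        0 < β → β ≤ 1 / 2 → 0 < γ → γ ≤ 1 →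
        conn (k + 1) β γ A →
        (2 : ℝ) ^ (k + 2) * γ⁻¹ * (A.card : ℝ) ^ (k + 1) ≤ (energyK (k + 1) A : ℝ) →
        (c * γ * (A.card : ℝ) ^ (2 * k + 1) ≤
            ∑ x ∈ (A - A).erase 0, ((stab A x).card : ℝ) ^ k * ((stab D x).card : ℝ) ^ k) ∧
        (c * γ * (A.card : ℝ) ^ (2 * k + 1) ≤
            ∑ x ∈ (A - A).erase 0, ((stab A x).card : ℝ) ^ k * ((stab S x).card : ℝ) ^ k) := by
  refine ⟨1 / 2 ^ (2 * k + 4), by positivity, ?_⟩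
  intro G _ _ A D S β γ hA hD hS _ hβ hγ _ hconn hE
  constructor
  · refine core k A (fun x => stab D x) (fun x b => A.image fun a => a - b - x)
      ?_ ?_ ?_ β γ hA hβ hγ hconn hE
    · intro x b hb t ht
      rw [mem_stab'] at hb
      obtain ⟨a, ha, rfl⟩ := Finset.mem_image.mp ht
      rw [mem_stab']
      refine ⟨hD ?_, hD ?_⟩
      · rw [sub_sub]; exact Finset.sub_mem_sub ha hb.2
      · rw [sub_add_cancel]; exact Finset.sub_mem_sub ha hb.1
    · intro x b
      exact Finset.card_image_of_injective _ fun a a' h => by simpa using h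
    · intro x b c
      refine Finset.card_le_card_of_injOn (fun t => t + c + x) ?_ ?_
      · intro t ht
        obtain ⟨h1, h2⟩ := Finset.mem_inter.mp ht
        obtain ⟨a, ha, rfl⟩ := Finset.mem_image.mp h1
        obtain ⟨a', ha', e⟩ := Finset.mem_image.mp h2
        refine (mem_stab' _ _ _).mpr ⟨?_, ?_⟩
        · have : a - b - x + c + x = a' := by rw [← e]; abel
          simpa only [this] using ha'
        · have : a - b - x + c + x + (b - c) = a := by abel
          simpa only [this] using ha
      · intro t _ t' _ h
        simpa using h
  · refine core k A (fun x => stab S x) (fun x b => A.image fun a => a + b)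
      ?_ ?_ ?_ β γ hA hβ hγ hconn hE
    · intro x b hb t ht
      rw [mem_stab'] at hb
      obtain ⟨a, ha, rfl⟩ := Finset.mem_image.mp ht
      rw [mem_stab']
      refine ⟨hS ?_, hS ?_⟩
      · exact Finset.add_mem_add ha hb.1
      · rw [add_assoc]; exact Finset.add_mem_add ha hb.2
    · intro x b
      exact Finset.card_image_of_injective _ fun a a' h => by simpa using h
    · intro x b c
      refine Finset.card_le_card_of_injOn (fun t => t - b) ?_ ?_
      · intro t ht
        obtain ⟨h1, h2⟩ := Finset.mem_inter.mp ht
        obtain ⟨a, ha, rfl⟩ := Finset.mem_image.mp h1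
        obtain ⟨a', ha', e⟩ := Finset.mem_image.mp h2
        refine (mem_stab' _ _ _).mpr ⟨?_, ?_⟩
        · have : a + b - b = a := by abel
          simpa only [this] using ha
        · have : a + b - b + (b - c) = a' := by rw [← e]; abel
          simpa only [this] using ha'
      · intro t _ t' _ h
        simpa using h
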